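/- Let n ≥ 2 and fix a symmetric matrix Z ∈ Matrix (Fin n) (Fin n) ℂ (Zᵀ = Z). (a) Fix i < j in Fin n; for w ∈ ℂ let Z(w) be the symmetric matrix agreeing with Z except that its (i,j) and (j,i) entries are both w, and let Z'' be obtained from Z by deleting rows i, j and columns i, j. Then there exist c_{kl} ∈ ℂ for 0 ≤ k, l ≤ 2 with (k,l) ≠ (2,2) such that for all w ∈ ℂ: det(I_n − Z(w) Z(w)ᴴ) = w²·conj(w)²·det(I_{n−2} − Z'' Z''ᴴ) + Σ_{(k,l) ≠ (2,2)} c_{kl} w^k conj(w)^l. (b) Fix i ∈ Fin n; for w ∈ ℂ let Z(w) be the symmetric matrix agreeing with Z except that its (i,i) entry is w, and let Z' be obtained from Z by deleting row i and column i. Then there exist a ∈ ℝ and c ∈ ℂ such that for all w ∈ ℂ: det(I_n − Z(w) Z(w)ᴴ) = a + c·w + conj(c·w) − w·conj(w)·det(I_{n−1} − Z' Z'ᴴ). -/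

import Mathlib

open Matrix

noncomputable section

/-- The symmetric matrix agreeing with `Z` except that its `(i,j)` and `(j,i)` entries are
both `w`. -/
def updEntrySym {n : ℕ} (Z : Matrix (Fin n) (Fin n) ℂ) (i j : Fin n) (w : ℂ) :
    Matrix (Fin n) (Fin n) ℂ :=
  Matrix.of fun a b =>
    if (a = i ∧ b = j) ∨ (a = j ∧ b = i) then w else Z a b

/-- The strictly monotone embedding `Fin m → Fin (m+2)` avoiding exactly `i` and `j`
(for `i < j`); used to delete rows/columns `i` and `j`. -/
def delTwo {m : ℕ} (i j : Fin (m + 2)) (hij : i < j) : Fin m → Fin (m + 2) :=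
  fun k => j.succAbove ((⟨(i : ℕ), by
    have h1 : (i : ℕ) < (j : ℕ) := hij
    have h2 := j.isLt
    omega⟩ : Fin (m + 1)).succAbove k)

namespace Matrix

section CommRing

variable {α ι κ R : Type*} [DecidableEq α] [Fintype ι] [DecidableEq ι]
  [Fintype κ] [DecidableEq κ] [CommRing R]

/-- Add `w` to the `(x, y)` entry and `v` to the `(y, x)` entry of `N`, written as row updates. -/
def addPair (N : Matrix α α R) (x y : α) (w v : R) : Matrix α α R :=
  (N.updateRow x (N x + w • Pi.single y 1)).updateRow y (N y + v • Pi.single x 1)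

/-- Replace the rows `x` and `y` of `N` by the corresponding rows of the identity matrix. -/
def unitRows (N : Matrix α α R) (x y : α) : Matrix α α R :=
  (N.updateRow x (Pi.single x 1)).updateRow y (Pi.single y 1)

theorem det_updateRow_single_swap [Fintype α] (N : Matrix α α R) {x y : α} (hxy : x ≠ y) :
    ((N.updateRow x (Pi.single y 1)).updateRow y (Pi.single x 1)).det =
      -(N.unitRows x y).det := by
  have h : (N.updateRow x (Pi.single y 1)).updateRow y (Pi.single x 1) =
      (N.unitRows x y).submatrix (Equiv.swap x y) id := by
    ext a b
    rcases eq_or_ne a x with rfl | hx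
    · simp [unitRows, hxy]
    rcases eq_or_ne a y with rfl | hy
    · simp [unitRows, hxy]
    simp [unitRows, hx, hy, Equiv.swap_apply_of_ne_of_ne]
  rw [h, det_permute, Equiv.Perm.sign_swap hxy]
  simp

theorem det_addPair [Fintype α] (N : Matrix α α R) {x y : α} (hxy : x ≠ y) (w v : R) :
    (N.addPair x y w v).det =
      N.det + w * (N.updateRow x (Pi.single y 1)).det + v * (N.updateRow y (Pi.single x 1)).det
        - w * v * (N.unitRows x y).det := by
  have hx (u : α → R) : (N.updateRow x u).updateRow y (N y) = N.updateRow x u := by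
    conv_rhs => rw [← updateRow_eq_self (N.updateRow x u) y, updateRow_ne hxy.symm]
  rw [addPair, det_updateRow_add, det_updateRow_smul, hx, updateRow_comm _ hxy,
    det_updateRow_add, det_updateRow_smul, updateRow_eq_self, det_updateRow_add,
    det_updateRow_smul, updateRow_comm _ hxy.symm, updateRow_comm _ hxy.symm, updateRow_eq_self,
    det_updateRow_single_swap N hxy]
  ring

theorem addPair_updateRow (N : Matrix α α R) {x y z : α} (hx : x ≠ z) (hy : y ≠ z) (w v : R)
    (u : α → R) :
    (N.addPair x y w v).updateRow z u = (N.updateRow z u).addPair x y w v := by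
  simp only [addPair, updateRow_ne hx, updateRow_ne hy]
  rw [updateRow_comm _ hy, updateRow_comm _ hx]

theorem addPair_unitRows (N : Matrix α α R) {x y x' y' : α} (hxx : x ≠ x') (hxy : x ≠ y')
    (hyx : y ≠ x') (hyy : y ≠ y') (w v : R) :
    (N.addPair x y w v).unitRows x' y' = (N.unitRows x' y').addPair x y w v := by
  rw [unitRows, addPair_updateRow _ hxx hyx, addPair_updateRow _ hxy hyy, unitRows]

open Classical in
theorem det_fromBlocks_one_mask (A B : Matrix ι ι R) {e : κ → ι} (he : Function.Injective e) :
    (fromBlocks 1 (of fun a b => if a ∈ Set.range e then A a b else 0)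
      (of fun a b => if a ∈ Set.range e then B a b else 0) 1).det =
      (1 - A.submatrix e e * B.submatrix e e).det := by
  let P : Matrix ι κ R := (1 : Matrix ι ι R).submatrix id e
  have hP : ∀ C : Matrix ι ι R,
      (of fun a b => if a ∈ Set.range e then C a b else 0) = P * (Pᵀ * C) := by
    intro C
    have hPC : Pᵀ * C = C.submatrix e id := by
      ext a b
      simp [P, mul_apply, one_apply]
    rw [hPC]
    ext a b
    by_cases ha : a ∈ Set.range e
    · obtain ⟨k, rfl⟩ := ha
      simp [P, mul_apply, one_apply, he.eq_iff]
    · have h (k : κ) : a ≠ e k := fun h => ha ⟨k, h.symm⟩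
      simp [P, mul_apply, h, fun k => (h k).symm]
  have hS : ∀ C : Matrix ι ι R, C.submatrix e e = Pᵀ * C * P := by
    intro C
    ext a b
    simp [P, mul_apply, one_apply]
  rw [det_fromBlocks_one₂₂, hP, hP, hS, hS, Matrix.mul_assoc P, det_one_sub_mul_comm]
  simp only [Matrix.mul_assoc]

end CommRing

end Matrix

section GenericNorm

theorem delTwo_injective {m : ℕ} (i j : Fin (m + 2)) (hij : i < j) :
    Function.Injective (delTwo i j hij) :=
  Fin.succAbove_right_injective.comp Fin.succAbove_right_injective

theorem mem_range_delTwo {m : ℕ} {i j : Fin (m + 2)} (hij : i < j) (a : Fin (m + 2)) :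
    a ∈ Set.range (delTwo i j hij) ↔ a ≠ i ∧ a ≠ j := by
  have hi : j.succAbove ⟨i, by omega⟩ = i := Fin.succAbove_of_castSucc_lt _ _ hij
  constructor
  · rintro ⟨k, rfl⟩
    refine ⟨fun h => ?_, Fin.succAbove_ne _ _⟩
    exact Fin.succAbove_ne _ _ (Fin.succAbove_right_injective (h.trans hi.symm))
  · rintro ⟨h1, h2⟩
    obtain ⟨b, rfl⟩ := Fin.exists_succAbove_eq h2
    have hb : b ≠ ⟨i, by omega⟩ := by
      rintro rfl
      exact h1 hi
    obtain ⟨k, rfl⟩ := Fin.exists_succAbove_eq hb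
    exact ⟨k, rfl⟩

theorem submatrix_updEntrySym {n m : ℕ} (Z : Matrix (Fin n) (Fin n) ℂ) (i j : Fin n) (w : ℂ)
    (e : Fin m → Fin n) (hi : ∀ k, e k ≠ i) (hj : ∀ k, e k ≠ j) :
    (updEntrySym Z i j w).submatrix e e = Z.submatrix e e := by
  ext a b
  simp [updEntrySym, hi, hj]

/-- The block matrix whose determinant is `det (1 - Z * Zᴴ)`. -/
def normBlock {n : ℕ} (Z : Matrix (Fin n) (Fin n) ℂ) :
    Matrix (Fin n ⊕ Fin n) (Fin n ⊕ Fin n) ℂ :=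
  fromBlocks 1 Z Zᴴ 1

theorem det_normBlock {n : ℕ} (Z : Matrix (Fin n) (Fin n) ℂ) :
    (normBlock Z).det = (1 - Z * Zᴴ).det :=
  det_fromBlocks_one₂₂ _ _ _

theorem normBlock_updEntrySym_diag {n : ℕ} (Z : Matrix (Fin n) (Fin n) ℂ) (i : Fin n) (w : ℂ) :
    normBlock (updEntrySym Z i i w) =
      (normBlock (updEntrySym Z i i 0)).addPair (.inl i) (.inr i) w (starRingEnd ℂ w) := by
  ext (a | a) (b | b) <;> by_cases ha : a = i <;> by_cases hb : b = i <;>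
    simp [normBlock, addPair, updEntrySym, updateRow_apply, ha, hb]

theorem normBlock_updEntrySym {n : ℕ} (Z : Matrix (Fin n) (Fin n) ℂ) {i j : Fin n} (hij : i ≠ j)
    (w : ℂ) :
    normBlock (updEntrySym Z i j w) =
      ((normBlock (updEntrySym Z i j 0)).addPair (.inl i) (.inr j) w (starRingEnd ℂ w)).addPair
        (.inl j) (.inr i) w (starRingEnd ℂ w) := by
  ext (a | a) (b | b) <;> by_cases ha : a = i <;> by_cases hb : b = i <;>
    by_cases ha' : a = j <;> by_cases hb' : b = j <;>
    simp_all [normBlock, addPair, updEntrySym, updateRow_apply]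

theorem det_unitRows_diag {m : ℕ} (Z : Matrix (Fin (m + 1)) (Fin (m + 1)) ℂ) (i : Fin (m + 1)) :
    ((normBlock Z).unitRows (.inl i) (.inr i)).det =
      (1 - Z.submatrix i.succAbove i.succAbove * (Z.submatrix i.succAbove i.succAbove)ᴴ).det := by
  classical
  rw [conjTranspose_submatrix, ← det_fromBlocks_one_mask _ _ Fin.succAbove_right_injective]
  congr 1
  ext (a | a) (b | b) <;> by_cases ha : a = i <;>
    simp [normBlock, unitRows, updateRow_apply, ha, Pi.single_apply, one_apply, eq_comm (a := b)]

theorem det_unitRows_delTwo {m : ℕ} (Z : Matrix (Fin (m + 2)) (Fin (m + 2)) ℂ)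
    {i j : Fin (m + 2)} (hij : i < j) :
    (((normBlock Z).unitRows (.inl j) (.inr i)).unitRows (.inl i) (.inr j)).det =
      (1 - Z.submatrix (delTwo i j hij) (delTwo i j hij) *
        (Z.submatrix (delTwo i j hij) (delTwo i j hij))ᴴ).det := by
  classical
  rw [conjTranspose_submatrix, ← det_fromBlocks_one_mask _ _ (delTwo_injective i j hij)]
  congr 1
  simp only [mem_range_delTwo]
  ext (a | a) (b | b) <;> rcases eq_or_ne a i with rfl | ha <;>
    rcases eq_or_ne a j with rfl | ha' <;>
    simp_all [normBlock, unitRows, updateRow_apply, Pi.single_apply, one_apply, eq_comm (a := b)]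

theorem star_det_one_sub_mul_conjTranspose {n : ℕ} (Z : Matrix (Fin n) (Fin n) ℂ) :
    starRingEnd ℂ (1 - Z * Zᴴ).det = (1 - Z * Zᴴ).det := by
  rw [starRingEnd_apply, ← det_conjTranspose]
  simp

end GenericNorm

/-- Lemma 3.1(3): on symmetric matrices, in `det(I_n − Z Zᴴ)` viewed as a function of a single
entry `w`: (a) for the off-diagonal entry `z_{ij}` (`i < j`) the coefficient of `w² (conj w)²`
(i.e. of `(Re z_{ij})⁴`) is `det(I_{n−2} − Z'' Z''ᴴ)`; (b) for the diagonal entry `z_{ii}` the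
coefficient of `w conj w` (i.e. of `(Re z_{ii})²`) is `−det(I_{n−1} − Z' Z'ᴴ)`. -/
theorem genericNorm_typeIII_entry_coefficients (m : ℕ)
    (Z : Matrix (Fin (m + 2)) (Fin (m + 2)) ℂ) (hZ : Zᵀ = Z) :
    (∀ (i j : Fin (m + 2)) (hij : i < j),
      ∃ c : Fin 3 → Fin 3 → ℂ, c 2 2 = 0 ∧ ∀ w : ℂ,
        (1 - updEntrySym Z i j w * (updEntrySym Z i j w)ᴴ).det
          = w ^ 2 * (starRingEnd ℂ) w ^ 2 *
              (1 - Z.submatrix (delTwo i j hij) (delTwo i j hij) *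
                (Z.submatrix (delTwo i j hij) (delTwo i j hij))ᴴ).det
            + ∑ k : Fin 3, ∑ l : Fin 3, c k l * w ^ (k : ℕ) * (starRingEnd ℂ) w ^ (l : ℕ)) ∧
    (∀ i : Fin (m + 2),
      ∃ (a : ℝ) (c : ℂ), ∀ w : ℂ,
        (1 - updEntrySym Z i i w * (updEntrySym Z i i w)ᴴ).det
          = (a : ℂ) + c * w + (starRingEnd ℂ) (c * w)
            - w * (starRingEnd ℂ) w *
              (1 - Z.submatrix i.succAbove i.succAbove *
                (Z.submatrix i.succAbove i.succAbove)ᴴ).det) := by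
  constructor
  · intro i j hij
    have hne : i ≠ j := hij.ne
    set N := normBlock (updEntrySym Z i j 0)
    let f (K : Matrix (Fin (m + 2) ⊕ Fin (m + 2)) (Fin (m + 2) ⊕ Fin (m + 2)) ℂ) (s : Fin 4) : ℂ :=
      ![K.det, (K.updateRow (.inl i) (Pi.single (.inr j) 1)).det,
        (K.updateRow (.inr j) (Pi.single (.inl i) 1)).det,
        (K.unitRows (.inl i) (.inr j)).det] s
    let p := f N
    let q := f (N.updateRow (.inl j) (Pi.single (.inr i) 1))
    let r := f (N.updateRow (.inr i) (Pi.single (.inl j) 1))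
    let t := f (N.unitRows (.inl j) (.inr i))
    refine ⟨!![p 0, p 2 + r 0, r 2;
      p 1 + q 0, q 2 + r 1 - p 3 - t 0, -r 3 - t 2;
      q 1, -q 3 - t 1, 0], rfl, fun w => ?_⟩
    have hf (K) : (K.addPair (.inl i) (.inr j) w (starRingEnd ℂ w)).det =
        f K 0 + w * f K 1 + starRingEnd ℂ w * f K 2 - w * starRingEnd ℂ w * f K 3 :=
      det_addPair K (by simp) _ _
    have ht : t 3 = (1 - Z.submatrix (delTwo i j hij) (delTwo i j hij) *
        (Z.submatrix (delTwo i j hij) (delTwo i j hij))ᴴ).det := by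
      have hk (k) := (mem_range_delTwo hij _).1 ⟨k, rfl⟩
      rw [← submatrix_updEntrySym Z i j 0 _ (fun k => (hk k).1) (fun k => (hk k).2)]
      exact det_unitRows_delTwo _ hij
    rw [← ht, ← det_normBlock, normBlock_updEntrySym Z hne, det_addPair _ (by simp),
      addPair_updateRow _ (by simpa) (by simp),
      addPair_updateRow _ (by simp) (by simpa using hne.symm),
      addPair_unitRows _ (by simpa) (by simp) (by simp) (by simpa using hne.symm), hf, hf, hf, hf]
    change p 0 + w * p 1 + starRingEnd ℂ w * p 2 - w * starRingEnd ℂ w * p 3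
      + w * (q 0 + w * q 1 + starRingEnd ℂ w * q 2 - w * starRingEnd ℂ w * q 3)
      + starRingEnd ℂ w * (r 0 + w * r 1 + starRingEnd ℂ w * r 2 - w * starRingEnd ℂ w * r 3)
      - w * starRingEnd ℂ w *
        (t 0 + w * t 1 + starRingEnd ℂ w * t 2 - w * starRingEnd ℂ w * t 3) = _
    simp [Fin.sum_univ_three]
    ring
  · intro i
    set T := (1 - Z.submatrix i.succAbove i.succAbove *
      (Z.submatrix i.succAbove i.succAbove)ᴴ).det
    obtain ⟨p, q, r, h⟩ : ∃ p q r : ℂ, ∀ w : ℂ,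
        (1 - updEntrySym Z i i w * (updEntrySym Z i i w)ᴴ).det =
          p + w * q + starRingEnd ℂ w * r - w * starRingEnd ℂ w * T := by
      let N := normBlock (updEntrySym Z i i 0)
      refine ⟨N.det, (N.updateRow (.inl i) (Pi.single (.inr i) 1)).det,
        (N.updateRow (.inr i) (Pi.single (.inl i) 1)).det, fun w => ?_⟩
      rw [← det_normBlock, normBlock_updEntrySym_diag, det_addPair _ (by simp), det_unitRows_diag,
        submatrix_updEntrySym Z i i 0 _ (Fin.succAbove_ne i) (Fin.succAbove_ne i)]
    have hTr : starRingEnd ℂ T = T := star_det_one_sub_mul_conjTranspose _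
    have hr (w : ℂ) := h w ▸ star_det_one_sub_mul_conjTranspose (updEntrySym Z i i w)
    simp only [map_sub, map_add, map_mul, Complex.conj_conj, hTr] at hr
    have hp : starRingEnd ℂ p = p := by simpa using hr 0
    have hqr : starRingEnd ℂ q = r := by
      have h1 := hr 1
      have h2 := hr Complex.I
      simp only [map_one, Complex.conj_I, hp] at h1 h2
      have hI := Complex.I_mul_I
      linear_combination (1 / 2 : ℂ) * h1 + (Complex.I / 2) * h2 +
        (starRingEnd ℂ q + q - r - starRingEnd ℂ r) / 2 * hI
    refine ⟨p.re, q, fun w => ?_⟩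
    rw [h, Complex.conj_eq_iff_re.1 hp, map_mul, hqr]
    ring
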